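/- There exists a universal constant c > 0 such that for every η > 0 there exists d₀ with the following property: for all d ≥ d₀ and all positive integers m ≤ c·d²/log⁴(d), if v⁽¹⁾, …, v⁽ᵐ⁾ are i.i.d. uniformly random points on the unit sphere S^{d−1} ⊆ ℝ^d, M is the m×m matrix with entries M_{i,j} = (v⁽ⁱ⁾·v⁽ʲ⁾)², and A = M − (1 − 1/d)·I_m − (1/d)·𝟙𝟙ᵀ, then Pr(‖A‖₂ < 1/2) ≥ 1 − η. -/

import Mathlib

open MeasureTheory Metric ProbabilityTheory

/-- The uniform (rotation-invariant) probability distribution on the unit sphere of `ℝ^d`,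
viewed as a measure on the ambient space. -/
noncomputable def uniformSphere (d : ℕ) : Measure (EuclideanSpace ℝ (Fin d)) :=
  ((volume : Measure (EuclideanSpace ℝ (Fin d))).toSphere Set.univ)⁻¹ •
    Measure.map Subtype.val ((volume : Measure (EuclideanSpace ℝ (Fin d))).toSphere)

/-- The operator (spectral) norm of a real matrix, i.e. the `ℓ² → ℓ²` operator norm. -/
noncomputable def opNorm {n : ℕ} (A : Matrix (Fin n) (Fin n) ℝ) : ℝ :=
  ‖LinearMap.toContinuousLinearMap (Matrix.toEuclideanLin A)‖

section SpectralMoments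

open Matrix

/-- Powers of a real symmetric matrix, seen through an orthonormal eigenbasis. -/
theorem Matrix.IsHermitian.pow_spectral {ι : Type*} [Fintype ι] [DecidableEq ι]
    {A : Matrix ι ι ℝ} (hA : A.IsHermitian) (s : ℕ) :
    A ^ s = (hA.eigenvectorUnitary : Matrix ι ι ℝ) * diagonal (fun i => hA.eigenvalues i ^ s) *
      (hA.eigenvectorUnitary : Matrix ι ι ℝ)ᵀ := by
  set U : Matrix ι ι ℝ := (hA.eigenvectorUnitary : Matrix ι ι ℝ) with hU
  have h1 : Uᵀ * U = 1 := by
    have := Unitary.coe_star_mul_self hA.eigenvectorUnitary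
    simpa [star_eq_conjTranspose] using this
  have h2 : U * Uᵀ = 1 := by
    have := Unitary.coe_mul_star_self hA.eigenvectorUnitary
    simpa [star_eq_conjTranspose] using this
  have h3 : A = U * diagonal hA.eigenvalues * Uᵀ := by
    have := hA.spectral_theorem
    rw [Unitary.conjStarAlgAut_apply] at this
    simpa [star_eq_conjTranspose] using this
  induction s with
  | zero => simp [h2]
  | succ s ih =>
    rw [pow_succ, ih]
    refine (congrArg (_ * ·) h3).trans ?_
    calc _ = U * diagonal (fun i => hA.eigenvalues i ^ s) * (Uᵀ * U) *
          diagonal hA.eigenvalues * Uᵀ := by simp only [Matrix.mul_assoc]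
      _ = _ := by
        rw [h1, Matrix.mul_one, Matrix.mul_assoc U, diagonal_mul_diagonal]
        simp only [pow_succ]

theorem Matrix.IsHermitian.trace_pow_eq {ι : Type*} [Fintype ι] [DecidableEq ι]
    {A : Matrix ι ι ℝ} (hA : A.IsHermitian) (s : ℕ) :
    (A ^ s).trace = ∑ i, hA.eigenvalues i ^ s := by
  have h1 : (hA.eigenvectorUnitary : Matrix ι ι ℝ)ᵀ * hA.eigenvectorUnitary = 1 := by
    have := Unitary.coe_star_mul_self hA.eigenvectorUnitary
    simpa [star_eq_conjTranspose] using this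
  rw [hA.pow_spectral s, Matrix.trace_mul_comm, ← Matrix.mul_assoc, h1, Matrix.one_mul,
    trace_diagonal]

/-- The moments `a ⬝ A ^ s a` are those of a positive measure on the eigenvalues. -/
theorem Matrix.IsHermitian.dotProduct_pow_mulVec {ι : Type*} [Fintype ι] [DecidableEq ι]
    {A : Matrix ι ι ℝ} (hA : A.IsHermitian)
    (a : ι → ℝ) (s : ℕ) :
    a ⬝ᵥ (A ^ s *ᵥ a) = ∑ i, (((hA.eigenvectorUnitary : Matrix ι ι ℝ)ᵀ *ᵥ a) i) ^ 2 *
      hA.eigenvalues i ^ s := by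
  rw [hA.pow_spectral s, ← mulVec_mulVec, ← mulVec_mulVec, dotProduct_mulVec, ← mulVec_transpose]
  simp only [dotProduct, mulVec_diagonal]
  exact Finset.sum_congr rfl fun i _ => by ring

theorem sum_mul_sum_pow_le {ι : Type*} [Fintype ι] {w μ : ι → ℝ} (hw : ∀ i, 0 ≤ w i)
    (hμ : ∀ i, 0 ≤ μ i) (s t : ℕ) :
    (∑ i, w i * μ i ^ s) * (∑ i, w i * μ i ^ t) ≤ (∑ i, w i) * ∑ i, w i * μ i ^ (s + t) := by
  have key : 0 ≤ ∑ i, ∑ j, w i * w j * ((μ i ^ s - μ j ^ s) * (μ i ^ t - μ j ^ t)) := by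
    refine Finset.sum_nonneg fun i _ => Finset.sum_nonneg fun j _ =>
      mul_nonneg (mul_nonneg (hw i) (hw j)) ?_
    rcases le_total (μ i) (μ j) with h | h
    · exact mul_nonneg_of_nonpos_of_nonpos (sub_nonpos.2 (pow_le_pow_left₀ (hμ i) h s))
        (sub_nonpos.2 (pow_le_pow_left₀ (hμ i) h t))
    · exact mul_nonneg (sub_nonneg.2 (pow_le_pow_left₀ (hμ j) h s))
        (sub_nonneg.2 (pow_le_pow_left₀ (hμ j) h t))
  have e : ∑ i, ∑ j, w i * w j * ((μ i ^ s - μ j ^ s) * (μ i ^ t - μ j ^ t)) =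
      (∑ i, w i * μ i ^ (s + t)) * (∑ j, w j) + (∑ i, w i) * (∑ j, w j * μ j ^ (s + t))
      - (∑ i, w i * μ i ^ s) * (∑ j, w j * μ j ^ t)
      - (∑ i, w i * μ i ^ t) * (∑ j, w j * μ j ^ s) := by
    simp only [Finset.sum_mul_sum, ← Finset.sum_add_distrib, ← Finset.sum_sub_distrib]
    exact Finset.sum_congr rfl fun i _ => Finset.sum_congr rfl fun j _ => by ring
  rw [e] at key
  linarith [mul_comm (∑ i, w i * μ i ^ (s + t)) (∑ j, w j),
    mul_comm (∑ i, w i * μ i ^ t) (∑ j, w j * μ j ^ s)]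

/-- A renewal-type recursion: the return weights `c` are dominated by the moment sequence. -/
theorem abs_mul_moment_le {ι : Type*} [Fintype ι] {w l : ι → ℝ} (hw : ∀ i, 0 ≤ w i)
    {c : ℕ → ℝ} {N : ℕ} (h0 : c 0 = 1)
    (hc : ∀ n, c (n + 1) = ∑ j ∈ Finset.range n, c j * ∑ i, w i * l i ^ (n - 1 - j))
    (hN : 16 * N * ∑ i, w i ≤ 1) (n : ℕ) (hn : n ≤ N) (s : ℕ) :
    |c n| * ∑ i, w i * (max |l i| 4⁻¹) ^ s ≤ ∑ i, w i * (max |l i| 4⁻¹) ^ (s + n) := by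
  have hμ : ∀ i, 0 ≤ max |l i| 4⁻¹ := fun i => le_max_of_le_left (abs_nonneg _)
  have hpos : ∀ s, 0 ≤ ∑ i, w i * (max |l i| 4⁻¹) ^ s := fun s =>
    Finset.sum_nonneg fun i _ => mul_nonneg (hw i) (pow_nonneg (hμ i) _)
  induction n using Nat.strong_induction_on generalizing s with
  | _ n ih =>
    rcases n with _ | n
    · simp [h0]
    rcases n with _ | n
    · simpa [hc 0] using hpos (s + 1)
    have hb : |c (n + 2)| ≤ N * ∑ i, w i * (max |l i| 4⁻¹) ^ n := by
      rw [hc (n + 1)]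
      calc _ ≤ ∑ j ∈ Finset.range (n + 1), ∑ i, w i * (max |l i| 4⁻¹) ^ n := by
            refine (Finset.abs_sum_le_sum_abs _ _).trans (Finset.sum_le_sum fun j hj => ?_)
            have hj' : j ≤ n := by simpa [Nat.lt_succ_iff] using hj
            rw [abs_mul]
            have h1 := ih j (by omega) (by omega) (n - j)
            rw [Nat.sub_add_cancel hj'] at h1
            refine le_trans (mul_le_mul_of_nonneg_left ?_ (abs_nonneg _)) h1
            refine (Finset.abs_sum_le_sum_abs _ _).trans (Finset.sum_le_sum fun i _ => ?_)
            rw [abs_mul, abs_of_nonneg (hw i), abs_pow]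
            exact mul_le_mul_of_nonneg_left
              (pow_le_pow_left₀ (abs_nonneg _) (le_max_left _ _) _) (hw i)
        _ = ((n + 1 : ℕ) : ℝ) * ∑ i, w i * (max |l i| 4⁻¹) ^ n := by simp
        _ ≤ _ := mul_le_mul_of_nonneg_right (by exact_mod_cast (by omega : n + 1 ≤ N)) (hpos n)
    have h16 : ∑ i, w i * (max |l i| 4⁻¹) ^ (n + s) ≤
        16 * ∑ i, w i * (max |l i| 4⁻¹) ^ (s + (n + 2)) := by
      rw [Finset.mul_sum]
      refine Finset.sum_le_sum fun i _ => ?_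
      have h4 : (1 : ℝ) ≤ 16 * (max |l i| 4⁻¹) ^ 2 := by
        have : (4⁻¹ : ℝ) ≤ max |l i| 4⁻¹ := le_max_right _ _
        nlinarith
      have : w i * (max |l i| 4⁻¹) ^ (n + s) * 1 ≤
          w i * (max |l i| 4⁻¹) ^ (n + s) * (16 * (max |l i| 4⁻¹) ^ 2) :=
        mul_le_mul_of_nonneg_left h4 (mul_nonneg (hw i) (pow_nonneg (hμ i) _))
      calc _ ≤ _ := by simpa using this
        _ = _ := by ring
    have hch := sum_mul_sum_pow_le hw hμ n s
    calc _ ≤ (N * ∑ i, w i * (max |l i| 4⁻¹) ^ n) * ∑ i, w i * (max |l i| 4⁻¹) ^ s :=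
          mul_le_mul_of_nonneg_right hb (hpos s)
      _ = N * ((∑ i, w i * (max |l i| 4⁻¹) ^ n) * ∑ i, w i * (max |l i| 4⁻¹) ^ s) := by ring
      _ ≤ N * ((∑ i, w i) * (16 * ∑ i, w i * (max |l i| 4⁻¹) ^ (s + (n + 2)))) := by
          refine mul_le_mul_of_nonneg_left (hch.trans ?_) (Nat.cast_nonneg _)
          exact mul_le_mul_of_nonneg_left h16 (Finset.sum_nonneg fun i _ => hw i)
      _ = (16 * N * ∑ i, w i) * ∑ i, w i * (max |l i| 4⁻¹) ^ (s + (n + 2)) := by ring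
      _ ≤ 1 * _ := mul_le_mul_of_nonneg_right hN (hpos _)
      _ = _ := one_mul _

/-- Appending one row and column to a symmetric matrix: the trace of an even power grows by at most
a quadratic form in the new column. -/
theorem trace_pow_rank_two_update_le {ι : Type*} [Fintype ι] [DecidableEq ι] {A : Matrix ι ι ℝ}
    (hA : A.IsHermitian) {a e : ι → ℝ} (he : e ⬝ᵥ e = 1) (hAe : A *ᵥ e = 0) (hae : a ⬝ᵥ e = 0)
    {N : ℕ} (hN2 : 2 ≤ N) (hNe : Even N) (hN : 16 * N * (a ⬝ᵥ a) ≤ 1) :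
    ((A + vecMulVec a e + vecMulVec e a) ^ N).trace ≤
      (A ^ N).trace + 16 * N ^ 2 * (a ⬝ᵥ (A ^ N *ᵥ a) + 4⁻¹ ^ N * (a ⬝ᵥ a)) := by
  set B := A + vecMulVec a e + vecMulVec e a with hB
  set w : ι → ℝ := fun i => (((hA.eigenvectorUnitary : Matrix ι ι ℝ)ᵀ *ᵥ a) i) ^ 2 with hw
  set l := hA.eigenvalues with hl
  have hw0 : ∀ i, 0 ≤ w i := fun i => sq_nonneg _
  have hmom : ∀ s, a ⬝ᵥ (A ^ s *ᵥ a) = ∑ i, w i * l i ^ s := hA.dotProduct_pow_mulVec a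
  have hea : e ⬝ᵥ a = 0 := by rw [dotProduct_comm, hae]
  have hAT : Aᵀ = A := by
    simpa [Matrix.IsHermitian, conjTranspose_eq_transpose_of_trivial] using hA
  have hsymA : ∀ s x y, x ⬝ᵥ (A ^ s *ᵥ y) = (A ^ s *ᵥ x) ⬝ᵥ y := by
    intro s x y
    rw [dotProduct_mulVec, ← mulVec_transpose, transpose_pow, hAT]
  have heA : ∀ x, e ⬝ᵥ (A *ᵥ x) = 0 := by
    intro x
    have := hsymA 1 e x
    simp only [pow_one] at this
    rw [this, hAe, zero_dotProduct]
  have hBT : Bᵀ = B := by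
    rw [hB, transpose_add, transpose_add, hAT, transpose_vecMulVec, transpose_vecMulVec]
    abel
  have hBv : ∀ x, B *ᵥ x = A *ᵥ x + (e ⬝ᵥ x) • a + (a ⬝ᵥ x) • e := by
    intro x
    rw [hB, add_mulVec, add_mulVec, vecMulVec_mulVec, vecMulVec_mulVec]
    ext i
    simp [mul_comm]
  -- the orbit of `e` under `B`
  set c : ℕ → ℝ := fun n => e ⬝ᵥ (B ^ n *ᵥ e) with hc
  set b : ℕ → ι → ℝ := fun n => ∑ j ∈ Finset.range n, c j • (A ^ (n - 1 - j) *ᵥ a) with hb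
  have hAb : ∀ n, A *ᵥ b n + c n • a = b (n + 1) := by
    intro n
    simp only [hb]
    rw [Finset.sum_range_succ, mulVec_sum]
    congr 1
    · refine Finset.sum_congr rfl fun j hj => ?_
      have hj' : j < n := Finset.mem_range.1 hj
      rw [mulVec_smul, mulVec_mulVec, ← pow_succ']
      congr 3
      omega
    · simp
  have heb : ∀ n, e ⬝ᵥ b n = 0 := by
    intro n
    cases n with
    | zero => simp [hb]
    | succ n => rw [← hAb, dotProduct_add, heA, dotProduct_smul, hea]; simp
  have horb : ∀ n, B ^ n *ᵥ e = b n + c n • e := by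
    intro n
    induction n with
    | zero => simp [hb, hc, he]
    | succ n ih =>
      have h1 : B ^ (n + 1) *ᵥ e = b (n + 1) + (a ⬝ᵥ b n) • e := by
        rw [pow_succ', ← mulVec_mulVec, ih, hBv, ← hAb, mulVec_add, mulVec_smul, hAe,
          dotProduct_add, dotProduct_add, heb, dotProduct_smul, dotProduct_smul, he, hae]
        simp
      have h2 : c (n + 1) = a ⬝ᵥ b n := by
        simp only [hc]
        rw [h1, dotProduct_add, heb, dotProduct_smul, he]
        simp
      rw [h1, h2]
  have hcs : ∀ n, c (n + 1) = a ⬝ᵥ b n := by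
    intro n
    simp only [hc]
    rw [pow_succ', ← mulVec_mulVec, horb, hBv, dotProduct_add, dotProduct_add, heA,
      dotProduct_smul, dotProduct_smul, hea, he, dotProduct_add a, dotProduct_smul, hae]
    simp
  have hab : ∀ k n, (A ^ k *ᵥ a) ⬝ᵥ b n =
      ∑ j ∈ Finset.range n, c j * ∑ i, w i * l i ^ (k + (n - 1 - j)) := by
    intro k n
    simp only [hb]
    rw [dotProduct_sum]
    refine Finset.sum_congr rfl fun j _ => ?_
    rw [dotProduct_smul, ← hsymA, mulVec_mulVec, ← pow_add, hmom, smul_eq_mul]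
  have hcrec : ∀ n, c (n + 1) = ∑ j ∈ Finset.range n, c j * ∑ i, w i * l i ^ (n - 1 - j) := by
    intro n
    rw [hcs]
    simpa using hab 0 n
  have hwsum : ∑ i, w i = a ⬝ᵥ a := by simpa using (hmom 0).symm
  have hq := abs_mul_moment_le hw0 (by simp [hc, he]) hcrec (N := N) (by rwa [hwsum])
  set H := ∑ i, w i * (max |l i| 4⁻¹) ^ (N - 2) with hH
  have hH0 : 0 ≤ H := Finset.sum_nonneg fun i _ =>
    mul_nonneg (hw0 i) (pow_nonneg (le_max_of_le_left (abs_nonneg _)) _)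
  have hbound : ∀ k < N, |(A ^ k *ᵥ a) ⬝ᵥ b (N - 1 - k)| ≤ (N - 1) * H := by
    intro k hk
    rw [hab]
    have hle : ((N - 1 - k : ℕ) : ℝ) ≤ N - 1 := by
      have : ((N - 1 - k : ℕ) : ℝ) + 1 ≤ N := by exact_mod_cast (by omega : N - 1 - k + 1 ≤ N)
      linarith
    calc _ ≤ ∑ j ∈ Finset.range (N - 1 - k), H := by
          refine (Finset.abs_sum_le_sum_abs _ _).trans (Finset.sum_le_sum fun j hj => ?_)
          have hj' := Finset.mem_range.1 hj
          rw [abs_mul]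
          have h1 := hq j (by omega) (N - 2 - j)
          rw [Nat.sub_add_cancel (by omega)] at h1
          refine le_trans (mul_le_mul_of_nonneg_left ?_ (abs_nonneg _)) h1
          refine (Finset.abs_sum_le_sum_abs _ _).trans (Finset.sum_le_sum fun i _ => ?_)
          rw [abs_mul, abs_of_nonneg (hw0 i), abs_pow,
            show k + (N - 1 - k - 1 - j) = N - 2 - j by omega]
          exact mul_le_mul_of_nonneg_left
            (pow_le_pow_left₀ (abs_nonneg _) (le_max_left _ _) _) (hw0 i)
      _ = ((N - 1 - k : ℕ) : ℝ) * H := by simp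
      _ ≤ _ := mul_le_mul_of_nonneg_right hle hH0
  have htel : ∀ n, B ^ n - A ^ n = ∑ k ∈ Finset.range n, A ^ k * (B - A) * B ^ (n - 1 - k) := by
    intro n
    induction n with
    | zero => simp
    | succ n ih =>
      have : B ^ (n + 1) - A ^ (n + 1) = (B ^ n - A ^ n) * B + A ^ n * (B - A) := by
        rw [pow_succ, pow_succ]; noncomm_ring
      rw [this, ih, Finset.sum_range_succ, Finset.sum_mul]
      congr 1
      · refine Finset.sum_congr rfl fun k hk => ?_
        have hk' := Finset.mem_range.1 hk
        rw [Matrix.mul_assoc _ _ B, ← pow_succ, show n - 1 - k + 1 = n + 1 - 1 - k by omega]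
      · simp
  have hBsym : ∀ s x y, x ⬝ᵥ (B ^ s *ᵥ y) = (B ^ s *ᵥ x) ⬝ᵥ y := by
    intro s x y
    rw [dotProduct_mulVec, ← mulVec_transpose, transpose_pow, hBT]
  have hAke : ∀ k, k ≠ 0 → A ^ k *ᵥ e = 0 := by
    intro k hk
    obtain ⟨k, rfl⟩ := Nat.exists_eq_succ_of_ne_zero hk
    rw [pow_succ, ← mulVec_mulVec, hAe, mulVec_zero]
  have hterm : ∀ k n, (A ^ k * (B - A) * B ^ n).trace =
      (B ^ n *ᵥ e) ⬝ᵥ (A ^ k *ᵥ a) + (B ^ n *ᵥ a) ⬝ᵥ (A ^ k *ᵥ e) := by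
    intro k n
    have : B - A = vecMulVec a e + vecMulVec e a := by rw [hB]; abel
    rw [this, Matrix.mul_add, Matrix.add_mul, trace_add, mul_vecMulVec, mul_vecMulVec,
      vecMulVec_mul, vecMulVec_mul, trace_vecMulVec, trace_vecMulVec, ← mulVec_transpose,
      ← mulVec_transpose, transpose_pow, hBT]
    rw [dotProduct_comm, dotProduct_comm (A ^ k *ᵥ e)]
  have htermle : ∀ k ∈ Finset.range N, (A ^ k * (B - A) * B ^ (N - 1 - k)).trace ≤
      (if k = 0 then (N - 1) * H else 0) + (N - 1) * H := by
    intro k hk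
    have hk' := Finset.mem_range.1 hk
    have h1 := le_of_abs_le (hbound k hk')
    rw [hterm, horb, add_dotProduct, smul_dotProduct]
    by_cases h0 : k = 0
    · subst h0
      have h2 : (B ^ (N - 1 - 0) *ᵥ a) ⬝ᵥ (A ^ 0 *ᵥ e) = (A ^ 0 *ᵥ a) ⬝ᵥ b (N - 1 - 0) := by
        rw [pow_zero, one_mulVec, one_mulVec, ← hBsym, horb, dotProduct_add, dotProduct_smul, hae]
        simp
      rw [h2, dotProduct_comm (b _)]
      simp only [pow_zero, one_mulVec, hea, if_true] at h1 ⊢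
      simp only [smul_zero]
      linarith
    · rw [hAke k h0, hsymA k e a, hAke k h0, dotProduct_comm (b _)]
      simp only [h0, if_false, zero_dotProduct, dotProduct_zero, smul_zero]
      linarith
  have hmain : (B ^ N).trace - (A ^ N).trace ≤ N ^ 2 * H := by
    rw [← trace_sub, htel, trace_sum]
    refine (Finset.sum_le_sum htermle).trans ?_
    rw [Finset.sum_add_distrib, Finset.sum_ite_eq' (Finset.range N) 0,
      if_pos (Finset.mem_range.2 (by omega)), Finset.sum_const, Finset.card_range, nsmul_eq_mul]
    nlinarith
  have hHle : H ≤ 16 * (a ⬝ᵥ (A ^ N *ᵥ a) + 4⁻¹ ^ N * (a ⬝ᵥ a)) := by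
    rw [hmom, ← hwsum, Finset.mul_sum, ← Finset.sum_add_distrib, Finset.mul_sum]
    refine Finset.sum_le_sum fun i _ => ?_
    set μ := max |l i| 4⁻¹ with hμ
    have h0 : (4⁻¹ : ℝ) ≤ μ := le_max_right _ _
    have hμ0 : 0 ≤ μ := le_trans (by norm_num) h0
    have h1 : μ ^ (N - 2) ≤ 16 * μ ^ N := by
      obtain ⟨M, rfl⟩ : ∃ M, N = M + 2 := ⟨N - 2, by omega⟩
      have : μ ^ M * 1 ≤ μ ^ M * (16 * μ ^ 2) :=
        mul_le_mul_of_nonneg_left (by nlinarith) (pow_nonneg hμ0 _)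
      simp only [Nat.add_sub_cancel]
      calc μ ^ M ≤ μ ^ M * (16 * μ ^ 2) := by simpa using this
        _ = _ := by ring
    have h2 : μ ^ N ≤ l i ^ N + 4⁻¹ ^ N := by
      rcases max_choice |l i| 4⁻¹ with h | h
      · rw [hμ, h, hNe.pow_abs]; simp
      · rw [hμ, h]; simpa using hNe.pow_nonneg (l i)
    calc w i * μ ^ (N - 2) ≤ w i * (16 * (l i ^ N + 4⁻¹ ^ N)) :=
          mul_le_mul_of_nonneg_left (by linarith) (hw0 i)
      _ = _ := by ring
  have := mul_le_mul_of_nonneg_left hHle (sq_nonneg (N : ℝ))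
  linarith

theorem Matrix.IsHermitian.eigenvalues_pow_le_trace {ι : Type*} [Fintype ι] [DecidableEq ι]
    {A : Matrix ι ι ℝ} (hA : A.IsHermitian) {N : ℕ} (hN : Even N) (i : ι) :
    hA.eigenvalues i ^ N ≤ (A ^ N).trace := by
  rw [hA.trace_pow_eq]
  exact Finset.single_le_sum (f := fun i => hA.eigenvalues i ^ N)
    (fun j _ => hN.pow_nonneg _) (Finset.mem_univ i)

theorem Matrix.IsHermitian.trace_pow_nonneg {ι : Type*} [Fintype ι] [DecidableEq ι]
    {A : Matrix ι ι ℝ} (hA : A.IsHermitian) {N : ℕ} (hN : Even N) : 0 ≤ (A ^ N).trace := by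
  rw [hA.trace_pow_eq]
  exact Finset.sum_nonneg fun i _ => hN.pow_nonneg _

theorem Matrix.IsHermitian.abs_eigenvalues_lt {ι : Type*} [Fintype ι] [DecidableEq ι]
    {A : Matrix ι ι ℝ} (hA : A.IsHermitian) {N : ℕ} (hN : Even N) {r : ℝ} (hr : 0 ≤ r)
    (h : (A ^ N).trace < r ^ N) (i : ι) : |hA.eigenvalues i| < r := by
  have := (hA.eigenvalues_pow_le_trace hN i).trans_lt h
  rw [← hN.pow_abs] at this
  exact lt_of_pow_lt_pow_left₀ N hr this

theorem Matrix.IsHermitian.trace_pow_succ_le {ι : Type*} [Fintype ι] [DecidableEq ι]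
    {A : Matrix ι ι ℝ} (hA : A.IsHermitian) {N : ℕ} (hN : Even N) (h : (A ^ N).trace < 1) :
    (A ^ (N + 1)).trace ≤ (A ^ N).trace := by
  rw [hA.trace_pow_eq, hA.trace_pow_eq]
  refine Finset.sum_le_sum fun i _ => ?_
  have := hA.abs_eigenvalues_lt hN zero_le_one (by simpa using h) i
  rw [pow_succ]
  exact mul_le_of_le_one_right (hN.pow_nonneg _) (abs_lt.1 this).2.le

theorem opNorm_lt_of_trace_pow_lt {m : ℕ} {A : Matrix (Fin m) (Fin m) ℝ} (hA : A.IsHermitian)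
    {N : ℕ} (hN : Even N) {r : ℝ} (hr : 0 < r) (h : (A ^ N).trace < r ^ N) : opNorm A < r := by
  obtain ⟨q, hq0, hqr, hq⟩ : ∃ q, 0 ≤ q ∧ q < r ∧ ∀ i, |hA.eigenvalues i| ≤ q := by
    rcases isEmpty_or_nonempty (Fin m) with h0 | h0
    · exact ⟨0, le_rfl, hr, fun i => (h0.false i).elim⟩
    · obtain ⟨i, hi⟩ := Finite.exists_max fun i => |hA.eigenvalues i|
      exact ⟨_, abs_nonneg _, hA.abs_eigenvalues_lt hN hr.le h i, hi⟩
  refine lt_of_le_of_lt (ContinuousLinearMap.opNorm_le_bound _ hq0 fun x => ?_) hqr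
  refine le_of_sq_le_sq ?_ (mul_nonneg hq0 (norm_nonneg _))
  have hAT : Aᵀ = A := by
    simpa [Matrix.IsHermitian, conjTranspose_eq_transpose_of_trivial] using hA
  have h1 : ‖LinearMap.toContinuousLinearMap (Matrix.toEuclideanLin A) x‖ ^ 2 =
      x.ofLp ⬝ᵥ (A ^ 2 *ᵥ x.ofLp) := by
    rw [EuclideanSpace.real_norm_sq_eq, pow_two A, ← mulVec_mulVec, dotProduct_mulVec,
      ← mulVec_transpose, hAT]
    simp [dotProduct, pow_two]
  have h2 : ‖x‖ ^ 2 = x.ofLp ⬝ᵥ (A ^ 0 *ᵥ x.ofLp) := by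
    rw [EuclideanSpace.real_norm_sq_eq]
    simp [dotProduct, pow_two]
  rw [mul_pow, h1, h2, hA.dotProduct_pow_mulVec, hA.dotProduct_pow_mulVec, Finset.mul_sum]
  refine Finset.sum_le_sum fun i _ => ?_
  rw [pow_zero, mul_one, mul_comm]
  refine mul_le_mul_of_nonneg_right ?_ (sq_nonneg _)
  rw [← sq_abs]
  exact pow_le_pow_left₀ (abs_nonneg _) (hq i) 2

end SpectralMoments
section Sphere

local notation "𝔼" d => EuclideanSpace ℝ (Fin d)

theorem isProbabilityMeasure_uniformSphere {d : ℕ} (hd : 1 ≤ d) :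
    IsProbabilityMeasure (uniformSphere d) := by
  have : Nonempty (Fin d) := ⟨⟨0, hd⟩⟩
  constructor
  rw [uniformSphere, Measure.smul_apply, Measure.map_apply measurable_subtype_coe .univ,
    Set.preimage_univ, smul_eq_mul, ENNReal.inv_mul_cancel]
  · rw [Measure.measure_univ_ne_zero]
    exact Measure.toSphere_ne_zero _
  · exact measure_ne_top _ _

theorem ae_norm_uniformSphere (d : ℕ) : ∀ᵐ x ∂uniformSphere d, ‖x‖ = 1 := by
  rw [uniformSphere]
  refine Measure.ae_smul_measure ?_ _
  rw [ae_map_iff measurable_subtype_coe.aemeasurable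
    (measurableSet_eq_fun measurable_norm measurable_const)]
  exact Filter.Eventually.of_forall fun x => by simp

open scoped Pointwise in
theorem measurePreserving_uniformSphere {d : ℕ} (L : (𝔼 d) ≃ₗᵢ[ℝ] (𝔼 d)) :
    MeasurePreserving L (uniformSphere d) (uniformSphere d) := by
  refine ⟨L.continuous.measurable, ?_⟩
  rw [uniformSphere, Measure.map_smul]
  congr 1
  ext s hs
  rw [Measure.map_apply L.continuous.measurable hs,
    Measure.map_apply measurable_subtype_coe (L.continuous.measurable hs),
    Measure.map_apply measurable_subtype_coe hs,
    Measure.toSphere_apply' _ (measurable_subtype_coe hs),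
    Measure.toSphere_apply' _ (measurable_subtype_coe (L.continuous.measurable hs))]
  congr 1
  rw [← L.measurePreserving.measure_preimage_equiv (f := L.toMeasurableEquiv)
    (Set.Ioo (0 : ℝ) 1 • (Subtype.val '' (Subtype.val ⁻¹' s : Set (sphere (0 : 𝔼 d) 1))))]
  congr 1
  ext x
  simp only [Set.mem_smul, Set.mem_image, Set.mem_preimage, Subtype.exists, mem_sphere_iff_norm,
    sub_zero]
  constructor
  · rintro ⟨r, hr, y, ⟨z, hz, hzs, rfl⟩, rfl⟩
    exact ⟨r, hr, L z, ⟨L z, by simpa using hz, hzs, rfl⟩, (map_smul L r z).symm⟩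
  · rintro ⟨r, hr, y, ⟨z, hz, hzs, rfl⟩, hx⟩
    refine ⟨r, hr, L.symm z, ⟨L.symm z, by simpa using hz, by simpa using hzs, rfl⟩, ?_⟩
    apply L.injective
    rw [map_smul, L.apply_symm_apply]
    exact hx

theorem integrable_uniformSphere {d : ℕ} (hd : 1 ≤ d) {f : (𝔼 d) → ℝ} (hf : Continuous f) :
    Integrable f (uniformSphere d) := by
  have := isProbabilityMeasure_uniformSphere hd
  obtain ⟨C, hC⟩ := (isCompact_sphere (0 : 𝔼 d) 1).exists_bound_of_continuousOn hf.continuousOn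
  refine Integrable.of_bound hf.aestronglyMeasurable C ?_
  filter_upwards [ae_norm_uniformSphere d] with x hx
  exact hC x (by simpa using hx)

theorem exists_linearIsometryEquiv_apply_eq {d : ℕ} {u w : 𝔼 d} (h : ‖u‖ = ‖w‖) :
    ∃ L : (𝔼 d) ≃ₗᵢ[ℝ] (𝔼 d), L u = w :=
  ⟨_, Submodule.reflection_sub h⟩

theorem integral_inner_pow_eq_of_norm_eq {d : ℕ} {u w : 𝔼 d} (h : ‖u‖ = ‖w‖) (k : ℕ) :
    ∫ x, inner ℝ u x ^ k ∂uniformSphere d = ∫ x, inner ℝ w x ^ k ∂uniformSphere d := by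
  obtain ⟨L, hL⟩ := exists_linearIsometryEquiv_apply_eq h
  have := (measurePreserving_uniformSphere L).integral_comp
    L.toHomeomorph.measurableEmbedding (fun x => inner ℝ w x ^ k)
  rw [← this]
  simp only [← hL, LinearIsometryEquiv.inner_map_map]

/-- Moments of linear forms on the sphere depend only on the length of the form. -/
theorem exists_integral_inner_pow {d : ℕ} (hd : 1 ≤ d) (k : ℕ) :
    ∃ μ : ℝ, ∀ u : 𝔼 d, ∫ x, inner ℝ u x ^ k ∂uniformSphere d = μ * ‖u‖ ^ k := by
  set e : 𝔼 d := EuclideanSpace.single ⟨0, hd⟩ 1 with he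
  have hen : ‖e‖ = 1 := by simp [he]
  refine ⟨∫ x, inner ℝ e x ^ k ∂uniformSphere d, fun u => ?_⟩
  have h : ‖u‖ = ‖‖u‖ • e‖ := by simp [norm_smul, hen]
  rw [integral_inner_pow_eq_of_norm_eq h, ← integral_mul_const]
  simp only [real_inner_smul_left, mul_pow, mul_comm]

theorem integral_inner_sq {d : ℕ} (hd : 1 ≤ d) (u : 𝔼 d) :
    ∫ x, inner ℝ u x ^ 2 ∂uniformSphere d = ‖u‖ ^ 2 / d := by
  have := isProbabilityMeasure_uniformSphere hd
  obtain ⟨μ, hμ⟩ := exists_integral_inner_pow hd 2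
  have h1 : ∑ i : Fin d, ∫ x, inner ℝ (EuclideanSpace.single i (1 : ℝ)) x ^ 2 ∂uniformSphere d =
      1 := by
    rw [← integral_finsetSum _ fun i _ => integrable_uniformSphere hd (by fun_prop)]
    rw [integral_congr_ae (g := fun _ => (1 : ℝ))]
    · simp
    · filter_upwards [ae_norm_uniformSphere d] with x hx
      have := EuclideanSpace.real_norm_sq_eq x
      rw [hx] at this
      simp [EuclideanSpace.inner_single_left, ← this]
  simp only [hμ] at h1
  have hd' : (d : ℝ) ≠ 0 := by positivity
  have : (d : ℝ) * μ = 1 := by simpa using h1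
  rw [hμ]
  field_simp
  linear_combination ‖u‖ ^ 2 * this

theorem integral_inner_sq_mul_inner_sq {d : ℕ} (hd : 1 ≤ d) (u w : 𝔼 d) :
    ∫ x, inner ℝ u x ^ 2 * inner ℝ w x ^ 2 ∂uniformSphere d =
      (‖u‖ ^ 2 * ‖w‖ ^ 2 + 2 * inner ℝ u w ^ 2) / (d * (d + 2)) := by
  have := isProbabilityMeasure_uniformSphere hd
  obtain ⟨μ, hμ⟩ := exists_integral_inner_pow hd 4
  have hpol : ∀ u w : 𝔼 d, ∫ x, inner ℝ u x ^ 2 * inner ℝ w x ^ 2 ∂uniformSphere d =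
      μ / 3 * (‖u‖ ^ 2 * ‖w‖ ^ 2 + 2 * inner ℝ u w ^ 2) := by
    intro u w
    have h1 : ∀ x : 𝔼 d, inner ℝ u x ^ 2 * inner ℝ w x ^ 2 = 12⁻¹ * (inner ℝ (u + w) x ^ 4 +
        inner ℝ (u - w) x ^ 4 - 2 * inner ℝ u x ^ 4 - 2 * inner ℝ w x ^ 4) := by
      intro x
      rw [inner_add_left, inner_sub_left]
      ring
    simp only [h1]
    rw [integral_const_mul, integral_sub, integral_sub, integral_add, integral_const_mul,
      integral_const_mul, hμ, hμ, hμ, hμ]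
    · have h2 := norm_add_sq_real u w
      have h3 := norm_sub_sq_real u w
      rw [show ‖u + w‖ ^ 4 = (‖u + w‖ ^ 2) ^ 2 by ring,
        show ‖u - w‖ ^ 4 = (‖u - w‖ ^ 2) ^ 2 by ring, h2, h3]
      ring
    all_goals exact integrable_uniformSphere hd (by fun_prop)
  have h1 : ∑ i : Fin d, ∑ j : Fin d, ∫ x, inner ℝ (EuclideanSpace.single i (1 : ℝ)) x ^ 2 *
      inner ℝ (EuclideanSpace.single j (1 : ℝ)) x ^ 2 ∂uniformSphere d = 1 := by
    have h : ∀ i : Fin d, ∑ j : Fin d, ∫ x, inner ℝ (EuclideanSpace.single i (1 : ℝ)) x ^ 2 *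
        inner ℝ (EuclideanSpace.single j (1 : ℝ)) x ^ 2 ∂uniformSphere d =
        ∫ x, ∑ j : Fin d, inner ℝ (EuclideanSpace.single i (1 : ℝ)) x ^ 2 *
          inner ℝ (EuclideanSpace.single j (1 : ℝ)) x ^ 2 ∂uniformSphere d := fun i =>
      (integral_finsetSum _ fun j _ => integrable_uniformSphere hd (by fun_prop)).symm
    simp only [h]
    rw [← integral_finsetSum _ fun i _ => integrable_uniformSphere hd (by fun_prop)]
    rw [integral_congr_ae (g := fun _ => (1 : ℝ))]
    · simp
    · filter_upwards [ae_norm_uniformSphere d] with x hx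
      have := EuclideanSpace.real_norm_sq_eq x
      rw [hx] at this
      simp [EuclideanSpace.inner_single_left, ← this, ← Finset.mul_sum]
  simp only [hpol] at h1
  have hd' : (0 : ℝ) < d := by positivity
  have h2 : ∀ i : Fin d, ∑ j : Fin d, (inner ℝ (EuclideanSpace.single i (1 : ℝ))
      (EuclideanSpace.single j (1 : ℝ))) ^ 2 = (1 : ℝ) := by
    intro i
    simp [EuclideanSpace.inner_single_left]
  simp only [← Finset.mul_sum, Finset.sum_add_distrib, h2] at h1
  have h3 : μ / 3 * (d * d + 2 * d) = 1 := by simpa using h1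
  rw [hpol]
  field_simp
  linear_combination (‖u‖ ^ 2 * ‖w‖ ^ 2 + 2 * inner ℝ u w ^ 2) * 3 * h3

/-- A Khintchine-type inequality for eighth moments of Rademacher sums. -/
theorem sum_signs_pow_eight_le {d : ℕ} {x : 𝔼 d} (hx : ‖x‖ = 1) :
    ∑ s ∈ Fintype.piFinset (fun _ : Fin d => ({1, -1} : Finset ℝ)), (∑ i, s i * x i) ^ 8 ≤
      161280 * 2 ^ d := by
  have h1 : ∀ y : ℝ, y ^ 8 ≤ 40320 * (Real.exp y + Real.exp (-y)) := by
    intro y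
    have h := Real.pow_div_factorial_le_exp |y| (abs_nonneg y) 8
    rw [(by decide : Even 8).pow_abs, div_le_iff₀ (by positivity)] at h
    have h2 : Real.exp |y| ≤ Real.exp y + Real.exp (-y) := by
      rcases abs_cases y with h | h <;> rw [h.1] <;> linarith [Real.exp_pos y, Real.exp_pos (-y)]
    have h3 : ((Nat.factorial 8 : ℕ) : ℝ) = 40320 := by norm_num [Nat.factorial]
    rw [h3] at h
    linarith
  have hne : (1 : ℝ) ≠ -1 := by norm_num
  have h2 : ∀ y : 𝔼 d, ‖y‖ = 1 → ∑ s ∈ Fintype.piFinset (fun _ : Fin d => ({1, -1} : Finset ℝ)),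
      Real.exp (∑ i, s i * y i) ≤ 2 * 2 ^ d := by
    intro y hy
    simp only [Real.exp_sum]
    rw [← Finset.prod_univ_sum (fun _ : Fin d => ({1, -1} : Finset ℝ))
      (fun i s => Real.exp (s * y i))]
    have hy2 := EuclideanSpace.real_norm_sq_eq y
    rw [hy] at hy2
    calc _ ≤ ∏ i : Fin d, 2 * Real.exp (y i ^ 2 / 2) := by
          refine Finset.prod_le_prod (fun i _ => Finset.sum_nonneg fun _ _ => (Real.exp_pos _).le)
            fun i _ => ?_
          rw [Finset.sum_pair hne]
          have := Real.cosh_le_exp_half_sq (y i)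
          rw [Real.cosh_eq] at this
          simp only [one_mul, neg_mul]
          linarith
      _ = Real.exp (1 / 2) * 2 ^ d := by
          rw [Finset.prod_mul_distrib, ← Real.exp_sum, ← Finset.sum_div, ← hy2]
          simp [mul_comm]
      _ ≤ _ := by
          refine mul_le_mul_of_nonneg_right ?_ (by positivity)
          have h := Real.exp_one_lt_d9
          have h' : Real.exp (1 / 2) ^ 2 = Real.exp 1 := by
            rw [← Real.exp_nat_mul]; norm_num
          nlinarith [Real.exp_pos (1 / 2)]
  calc _ ≤ ∑ s ∈ Fintype.piFinset (fun _ : Fin d => ({1, -1} : Finset ℝ)),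
        40320 * (Real.exp (∑ i, s i * x i) + Real.exp (∑ i, s i * (-x) i)) := by
        refine Finset.sum_le_sum fun s _ => (h1 _).trans_eq ?_
        simp
    _ ≤ _ := by
        rw [← Finset.mul_sum, Finset.sum_add_distrib]
        linarith [h2 x hx, h2 (-x) (by rwa [norm_neg])]

theorem integral_inner_pow_eight_le {d : ℕ} (hd : 1 ≤ d) {u : 𝔼 d} (hu : ‖u‖ = 1) :
    ∫ x, inner ℝ u x ^ 8 ∂uniformSphere d ≤ 161280 / d ^ 4 := by
  have := isProbabilityMeasure_uniformSphere hd
  obtain ⟨μ, hμ⟩ := exists_integral_inner_pow hd 8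
  have hne : (1 : ℝ) ≠ -1 := by norm_num
  set S := Fintype.piFinset (fun _ : Fin d => ({1, -1} : Finset ℝ)) with hS
  have h1 : ∑ s ∈ S, ∫ x, inner ℝ (WithLp.toLp 2 s : 𝔼 d) x ^ 8 ∂uniformSphere d ≤
      161280 * 2 ^ d := by
    rw [← integral_finsetSum _ fun i _ => integrable_uniformSphere hd (by fun_prop)]
    calc _ ≤ ∫ _, (161280 * 2 ^ d : ℝ) ∂uniformSphere d := by
          refine integral_mono_ae (integrable_uniformSphere hd (by fun_prop))
            (integrable_const _) ?_
          filter_upwards [ae_norm_uniformSphere d] with x hx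
          have := sum_signs_pow_eight_le hx
          simpa [PiLp.inner_apply, mul_comm] using this
      _ = _ := by simp
  have h2 : ∀ s ∈ S, ‖(WithLp.toLp 2 s : 𝔼 d)‖ ^ 8 = (d : ℝ) ^ 4 := by
    intro s hs
    have h : ∀ i, s i ^ 2 = 1 := by
      intro i
      have := Fintype.mem_piFinset.1 hs i
      simp only [Finset.mem_insert, Finset.mem_singleton] at this
      rcases this with h | h <;> rw [h] <;> norm_num
    rw [show ‖(WithLp.toLp 2 s : 𝔼 d)‖ ^ 8 = (‖(WithLp.toLp 2 s : 𝔼 d)‖ ^ 2) ^ 4 by ring,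
      EuclideanSpace.real_norm_sq_eq]
    simp [h]
  have hcard : (S.card : ℝ) = 2 ^ d := by
    simp [hS, Fintype.card_piFinset, Finset.card_pair hne]
  rw [Finset.sum_congr rfl fun s hs => (hμ _).trans (by rw [h2 s hs]), Finset.sum_const,
    nsmul_eq_mul, hcard] at h1
  have hd' : (0 : ℝ) < d := by positivity
  rw [hμ, hu, one_pow, mul_one, le_div_iff₀ (by positivity)]
  have : (0 : ℝ) < 2 ^ d := by positivity
  nlinarith

end Sphere

section Kernel

local notation "𝔼" d => EuclideanSpace ℝ (Fin d)

/-- The centered squared inner product. -/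
noncomputable def centeredSq {d : ℕ} (x y : EuclideanSpace ℝ (Fin d)) : ℝ :=
  inner ℝ x y ^ 2 - 1 / d

theorem centeredSq_comm {d : ℕ} (x y : 𝔼 d) : centeredSq x y = centeredSq y x := by
  rw [centeredSq, centeredSq, real_inner_comm]

theorem centeredSq_self {d : ℕ} {x : 𝔼 d} (hx : ‖x‖ = 1) : centeredSq x x = 1 - 1 / d := by
  rw [centeredSq, real_inner_self_eq_norm_sq, hx]; norm_num

@[fun_prop]
theorem Continuous.centeredSq {X : Type*} [TopologicalSpace X] {d : ℕ} {f g : X → 𝔼 d}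
    (hf : Continuous f) (hg : Continuous g) : Continuous fun x => centeredSq (f x) (g x) := by
  unfold _root_.centeredSq
  fun_prop

theorem integral_centeredSq_mul {d : ℕ} (hd : 1 ≤ d) {u w : 𝔼 d} (hu : ‖u‖ = 1) (hw : ‖w‖ = 1) :
    ∫ x, centeredSq u x * centeredSq w x ∂uniformSphere d =
      2 / (d * (d + 2)) * centeredSq u w := by
  have := isProbabilityMeasure_uniformSphere hd
  have hd' : (0 : ℝ) < d := by positivity
  have h1 : ∀ x : 𝔼 d, centeredSq u x * centeredSq w x = inner ℝ u x ^ 2 * inner ℝ w x ^ 2 -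
      inner ℝ u x ^ 2 * (1 / d) - inner ℝ w x ^ 2 * (1 / d) + (1 / d) ^ 2 := by
    intro x
    simp only [centeredSq]
    ring
  simp only [h1]
  rw [integral_add, integral_sub, integral_sub, integral_inner_sq_mul_inner_sq hd,
    integral_mul_const, integral_mul_const, integral_inner_sq hd, integral_inner_sq hd,
    integral_const, hu, hw, centeredSq]
  · simp only [probReal_univ, smul_eq_mul]
    field_simp
    ring
  all_goals exact integrable_uniformSphere hd (by fun_prop)

theorem integral_centeredSq_sq {d : ℕ} (hd : 1 ≤ d) {u : 𝔼 d} (hu : ‖u‖ = 1) :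
    ∫ x, centeredSq u x ^ 2 ∂uniformSphere d = 2 / (d * (d + 2)) * (1 - 1 / d) := by
  simp only [pow_two, integral_centeredSq_mul hd hu hu, centeredSq_self hu]

theorem integral_centeredSq_pow_four_le {d : ℕ} (hd : 1 ≤ d) {u : 𝔼 d} (hu : ‖u‖ = 1) :
    ∫ x, centeredSq u x ^ 4 ∂uniformSphere d ≤ 2000000 / d ^ 4 := by
  have := isProbabilityMeasure_uniformSphere hd
  have hd' : (0 : ℝ) < d := by positivity
  calc _ ≤ ∫ x, (8 * inner ℝ u x ^ 8 + 8 * (1 / d) ^ 4) ∂uniformSphere d := by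
        refine integral_mono (integrable_uniformSphere hd (by fun_prop))
          (integrable_uniformSphere hd (by fun_prop)) fun x => ?_
        simp only [centeredSq]
        rw [show (inner ℝ u x : ℝ) ^ 8 = (inner ℝ u x ^ 2) ^ 4 by ring]
        generalize (inner ℝ u x : ℝ) ^ 2 = s, (1 / d : ℝ) = t
        have h1 : (s - t) ^ 2 ≤ 2 * (s ^ 2 + t ^ 2) := by nlinarith [sq_nonneg (s + t)]
        have h2 := pow_le_pow_left₀ (sq_nonneg (s - t)) h1 2
        nlinarith [sq_nonneg (s ^ 2 - t ^ 2)]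
    _ = 8 * ∫ x, inner ℝ u x ^ 8 ∂uniformSphere d + 8 * (1 / d) ^ 4 := by
        rw [integral_add, integral_const_mul]
        · simp
        all_goals exact integrable_uniformSphere hd (by fun_prop)
    _ ≤ 8 * (161280 / d ^ 4) + 8 * (1 / d) ^ 4 := by
        gcongr
        exact integral_inner_pow_eight_le hd hu
    _ ≤ _ := by
        rw [div_pow, one_pow, mul_div_assoc', mul_one_div, ← add_div]
        gcongr
        norm_num

/-- The second moment of `centeredSq u` on the sphere, for a unit vector `u`. -/
noncomputable def centeredSqVar (d : ℕ) : ℝ := 2 / (d * (d + 2)) * (1 - 1 / d)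

theorem integral_centeredSq_sq_sub {d : ℕ} (hd : 1 ≤ d) {u : 𝔼 d} (hu : ‖u‖ = 1) :
    ∫ x, (centeredSq u x ^ 2 - centeredSqVar d) ∂uniformSphere d = 0 := by
  have := isProbabilityMeasure_uniformSphere hd
  rw [integral_sub, integral_centeredSq_sq hd hu, centeredSqVar]
  · simp
  all_goals exact integrable_uniformSphere hd (by fun_prop)

theorem integral_centeredSq_sq_sub_sq_le {d : ℕ} (hd : 1 ≤ d) {u : 𝔼 d} (hu : ‖u‖ = 1) :
    ∫ x, (centeredSq u x ^ 2 - centeredSqVar d) ^ 2 ∂uniformSphere d ≤ 2000000 / d ^ 4 := by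
  have := isProbabilityMeasure_uniformSphere hd
  have h1 : ∀ x : 𝔼 d, (centeredSq u x ^ 2 - centeredSqVar d) ^ 2 = centeredSq u x ^ 4 -
      2 * centeredSqVar d * (centeredSq u x ^ 2 - centeredSqVar d) - centeredSqVar d ^ 2 :=
    fun x => by ring
  simp only [h1]
  rw [integral_sub, integral_sub, integral_const_mul, integral_centeredSq_sq_sub hd hu]
  · have := integral_centeredSq_pow_four_le hd hu
    simp only [integral_const, probReal_univ, smul_eq_mul]
    nlinarith [sq_nonneg (centeredSqVar d)]
  all_goals exact integrable_uniformSphere hd (by fun_prop)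

end Kernel

section Resampling

/-- Resampling one coordinate of an i.i.d. family does not change its law. -/
theorem measurePreserving_update {ι α : Type*} [Fintype ι] [DecidableEq ι] [MeasurableSpace α]
    (σ : Measure α) [IsProbabilityMeasure σ] (i : ι) :
    MeasurePreserving (fun p : (ι → α) × α => Function.update p.1 i p.2)
      ((Measure.pi fun _ : ι => σ).prod σ) (Measure.pi fun _ : ι => σ) := by
  have hm : Measurable (fun p : (ι → α) × α => Function.update p.1 i p.2) := by
    refine measurable_pi_iff.2 fun j => ?_
    by_cases h : j = i
    · subst h
      simpa using measurable_snd
    · simp only [Function.update_of_ne h]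
      fun_prop
  refine ⟨hm, (Measure.pi_eq fun s hs => ?_).symm⟩
  rw [Measure.map_apply hm (MeasurableSet.univ_pi hs)]
  have : (fun p : (ι → α) × α => Function.update p.1 i p.2) ⁻¹' (Set.univ.pi s) =
      (Set.univ.pi (Function.update s i Set.univ)) ×ˢ s i := by
    ext ⟨v, x⟩
    simp only [Set.mem_preimage, Set.mem_univ_pi, Set.mem_prod]
    constructor
    · intro h
      refine ⟨fun j => ?_, by simpa using h i⟩
      by_cases hj : j = i
      · subst hj; simp
      · simpa [hj] using h j
    · rintro ⟨h, hx⟩ j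
      by_cases hj : j = i
      · subst hj; simpa using hx
      · simpa [hj] using h j
  rw [this, Measure.prod_prod, Measure.pi_pi, ← Finset.prod_erase_mul _ _ (Finset.mem_univ i),
    
    ← Finset.prod_erase_mul Finset.univ (fun j => σ (s j)) (Finset.mem_univ i)]
  simp only [Function.update_self, measure_univ, mul_one]
  congr 1
  refine Finset.prod_congr rfl fun j hj => ?_
  rw [Function.update_of_ne (Finset.ne_of_mem_erase hj)]

theorem integral_pi_eq_integral_update {ι α : Type*} [Fintype ι] [DecidableEq ι]
    [MeasurableSpace α] (σ : Measure α) [IsProbabilityMeasure σ] (i : ι) {F : (ι → α) → ℝ}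
    (hF : Integrable F (Measure.pi fun _ : ι => σ)) :
    ∫ v, F v ∂(Measure.pi fun _ : ι => σ) =
      ∫ v, ∫ x, F (Function.update v i x) ∂σ ∂(Measure.pi fun _ : ι => σ) := by
  have h := measurePreserving_update (ι := ι) σ i
  have hF' := hF
  rw [← h.map_eq] at hF'
  conv_lhs => rw [← h.map_eq]
  rw [integral_map h.measurable.aemeasurable hF'.aestronglyMeasurable]
  exact integral_prod _ (hF'.comp_measurable h.measurable)

theorem ae_norm_pi_uniformSphere {d : ℕ} (hd : 1 ≤ d) (m : ℕ) :
    ∀ᵐ v ∂(Measure.pi fun _ : Fin m => uniformSphere d), ∀ i, ‖v i‖ = 1 := by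
  have := isProbabilityMeasure_uniformSphere hd
  refine ae_all_iff.2 fun i => ?_
  exact (measurePreserving_eval (fun _ : Fin m => uniformSphere d) i).quasiMeasurePreserving.ae
    (ae_norm_uniformSphere d)

theorem integrable_pi_uniformSphere {d m : ℕ} (hd : 1 ≤ d)
    {F : (Fin m → EuclideanSpace ℝ (Fin d)) → ℝ} (hF : Continuous F) :
    Integrable F (Measure.pi fun _ : Fin m => uniformSphere d) := by
  have := isProbabilityMeasure_uniformSphere hd
  have hK : IsCompact (Set.univ.pi fun _ : Fin m => sphere (0 : EuclideanSpace ℝ (Fin d)) 1) :=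
    isCompact_univ_pi fun _ => isCompact_sphere _ _
  obtain ⟨C, hC⟩ := hK.exists_bound_of_continuousOn hF.continuousOn
  refine Integrable.of_bound hF.aestronglyMeasurable C ?_
  filter_upwards [ae_norm_pi_uniformSphere hd m] with v hv
  exact hC v fun i _ => by simpa using hv i

end Resampling

section PartialGram

open Matrix

local notation "𝔼" d => EuclideanSpace ℝ (Fin d)

/-- The entries of row `i` to the left of the diagonal. -/
noncomputable def lowerRow {d m : ℕ} (v : Fin m → EuclideanSpace ℝ (Fin d)) (i : Fin m) :
    Fin m → ℝ :=
  fun j => if j < i then centeredSq (v i) (v j) else 0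

/-- The off-diagonal centered Gram matrix of the first `n` vectors, padded by zeros. -/
noncomputable def partialGram {d m : ℕ} (v : Fin m → EuclideanSpace ℝ (Fin d)) (n : ℕ) :
    Matrix (Fin m) (Fin m) ℝ :=
  Matrix.of fun i j => if i ≠ j ∧ i.val < n ∧ j.val < n then centeredSq (v i) (v j) else 0

theorem isHermitian_partialGram {d m : ℕ} (v : Fin m → 𝔼 d) (n : ℕ) :
    (partialGram v n).IsHermitian := by
  ext i j
  simp only [partialGram, conjTranspose_apply, of_apply, star_trivial, centeredSq_comm (v i),
    ne_comm (a := i)]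
  congr 1
  rw [and_comm (a := j.val < n)]

theorem partialGram_zero {d m : ℕ} (v : Fin m → 𝔼 d) : partialGram v 0 = 0 := by
  ext i j
  simp [partialGram]

theorem partialGram_succ {d m : ℕ} (v : Fin m → 𝔼 d) (i : Fin m) :
    partialGram v (i + 1) = partialGram v i + vecMulVec (lowerRow v i) (Pi.single i 1) +
      vecMulVec (Pi.single i 1) (lowerRow v i) := by
  ext j k
  simp only [partialGram, lowerRow, Matrix.add_apply, of_apply, vecMulVec_apply, Pi.single_apply]
  by_cases hj : j = i
  · by_cases hk : k = i
    · simp [hj, hk]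
    · subst hj
      by_cases h : k < j
      · have : k.val < j.val + 1 := Nat.lt_succ_of_lt h
        simp [hk, h, this, ne_comm (a := j)]
      · have : ¬ k.val < j.val + 1 := by
          intro h'
          exact hk (Fin.ext (by have : ¬ k.val < j.val := h; omega))
        simp [hk, h, this]
  · by_cases hk : k = i
    · subst hk
      by_cases h : j < k
      · have : j.val < k.val + 1 := Nat.lt_succ_of_lt h
        simp [hj, h, this, centeredSq_comm (v k)]
      · have : ¬ j.val < k.val + 1 := by
          intro h'
          exact hj (Fin.ext (by have : ¬ j.val < k.val := h; omega))
        simp [hj, h, this]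
    · have h1 : j.val < i.val + 1 ↔ j.val < i.val := by
        have : j.val ≠ i.val := fun h => hj (Fin.ext h)
        omega
      have h2 : k.val < i.val + 1 ↔ k.val < i.val := by
        have : k.val ≠ i.val := fun h => hk (Fin.ext h)
        omega
      simp [hj, hk, h1, h2]

theorem partialGram_mulVec_single {d m : ℕ} (v : Fin m → 𝔼 d) (i : Fin m) :
    partialGram v i *ᵥ Pi.single i 1 = 0 := by
  ext j
  simp [partialGram]

theorem lowerRow_dotProduct_single {d m : ℕ} (v : Fin m → 𝔼 d) (i : Fin m) :
    lowerRow v i ⬝ᵥ Pi.single i 1 = 0 := by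
  simp [lowerRow]

theorem partialGram_update {d m : ℕ} (v : Fin m → 𝔼 d) (i : Fin m) (x : 𝔼 d) {n : ℕ}
    (hn : n ≤ i) : partialGram (Function.update v i x) n = partialGram v n := by
  ext j k
  simp only [partialGram, of_apply]
  split_ifs with h
  · have hj : j ≠ i := by rintro rfl; omega
    have hk : k ≠ i := by rintro rfl; omega
    simp [hj, hk]
  · rfl

theorem lowerRow_update {d m : ℕ} (v : Fin m → 𝔼 d) (i : Fin m) (x : 𝔼 d) {j : Fin m}
    (hj : j < i) : lowerRow (Function.update v i x) j = lowerRow v j := by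
  ext k
  simp only [lowerRow]
  split_ifs with h
  · simp [hj.ne, (h.trans hj).ne]
  · rfl

theorem lowerRow_update_self {d m : ℕ} (v : Fin m → 𝔼 d) (i : Fin m) (x : 𝔼 d) (j : Fin m) :
    lowerRow (Function.update v i x) i j = if j < i then centeredSq (v j) x else 0 := by
  simp only [lowerRow]
  split_ifs with h
  · simp [h.ne, centeredSq_comm x]
  · rfl

@[fun_prop]
theorem continuous_lowerRow {d m : ℕ} (i : Fin m) :
    Continuous fun v : Fin m → 𝔼 d => lowerRow v i := by
  refine continuous_pi fun j => ?_
  simp only [lowerRow]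
  split_ifs <;> fun_prop

@[fun_prop]
theorem continuous_partialGram {d m : ℕ} (n : ℕ) :
    Continuous fun v : Fin m → 𝔼 d => partialGram v n := by
  refine continuous_matrix fun i j => ?_
  simp only [partialGram, of_apply]
  split_ifs <;> fun_prop

theorem measureReal_lt_lowerRow_sq_le {d m : ℕ} (hd : 1 ≤ d) (i : Fin m) {ε : ℝ} (hε : 0 < ε)
    (hm : m * centeredSqVar d ≤ ε / 2) :
    (Measure.pi fun _ : Fin m => uniformSphere d).real
      {v | ε < lowerRow v i ⬝ᵥ lowerRow v i} ≤ m * (2000000 / d ^ 4) * (4 / ε ^ 2) := by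
  have := isProbabilityMeasure_uniformSphere hd
  have hd' : (1 : ℝ) ≤ d := by exact_mod_cast hd
  set μ := Measure.pi fun _ : Fin m => uniformSphere d with hμ
  have hvar : 0 ≤ centeredSqVar d := by
    refine mul_nonneg (by positivity) (sub_nonneg.2 ?_)
    exact div_le_one_of_le₀ hd' (by positivity)
  set W : Fin m → (Fin m → 𝔼 d) → ℝ := fun j v =>
    if j < i then centeredSq (v i) (v j) ^ 2 - centeredSqVar d else 0 with hW
  have hWc : ∀ j, Continuous (W j) := by
    intro j
    simp only [hW]
    split_ifs <;> fun_prop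
  have hint : ∀ j k, Integrable (fun v => W j v * W k v) μ := fun j k =>
    integrable_pi_uniformSphere hd ((hWc j).mul (hWc k))
  have hcross : ∀ j k, j ≠ k → ∫ v, W j v * W k v ∂μ = 0 := by
    intro j k hjk
    by_cases hj : j < i
    · rw [hμ, integral_pi_eq_integral_update _ j (hint j k)]
      refine (integral_congr_ae ?_).trans (integral_zero _ _)
      filter_upwards [ae_norm_pi_uniformSphere hd m] with v hv
      have h1 : ∀ x, W k (Function.update v j x) = W k v := by
        intro x
        simp only [hW, Function.update_of_ne hj.ne', Function.update_of_ne hjk.symm]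
      simp only [h1]
      rw [integral_mul_const]
      simp only [hW, hj, if_true, Function.update_self, Function.update_of_ne hj.ne']
      rw [integral_centeredSq_sq_sub hd (hv i), zero_mul]
    · simp [hW, hj]
  have hdiag : ∀ j, ∫ v, W j v * W j v ∂μ ≤ 2000000 / d ^ 4 := by
    intro j
    by_cases hj : j < i
    · rw [hμ, integral_pi_eq_integral_update _ j (hint j j)]
      calc _ ≤ ∫ v, (2000000 / d ^ 4 : ℝ) ∂μ := by
            refine integral_mono_of_nonneg
              (Filter.Eventually.of_forall fun v => integral_nonneg fun x => mul_self_nonneg _)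
              (integrable_const _) ?_
            filter_upwards [ae_norm_pi_uniformSphere hd m] with v hv
            simp only [hW, hj, if_true, Function.update_self, Function.update_of_ne hj.ne',
              ← pow_two]
            exact integral_centeredSq_sq_sub_sq_le hd (hv i)
        _ = _ := by simp [hμ]
    · simp only [hW, hj, if_false, mul_zero, integral_zero]
      positivity
  have hsq : ∫ v, (∑ j, W j v) ^ 2 ∂μ ≤ m * (2000000 / d ^ 4) := by
    simp only [pow_two, Finset.sum_mul_sum]
    rw [integral_finsetSum _ fun j _ => integrable_finsetSum _ fun k _ => hint j k]
    simp_rw [integral_finsetSum _ fun k _ => hint _ k]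
    calc _ ≤ ∑ j : Fin m, (2000000 / d ^ 4 : ℝ) := by
          refine Finset.sum_le_sum fun j _ => ?_
          rw [Finset.sum_eq_single j (fun k _ hk => hcross j k hk.symm) (by simp)]
          exact hdiag j
      _ = _ := by simp
  have hmk := mul_meas_ge_le_integral_of_nonneg (μ := μ) (f := fun v => (∑ j, W j v) ^ 2)
    (Filter.Eventually.of_forall fun v => sq_nonneg _)
    (integrable_pi_uniformSphere hd (by fun_prop)) ((ε / 2) ^ 2)
  have hsub : μ.real {v | ε < lowerRow v i ⬝ᵥ lowerRow v i} ≤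
      μ.real {v | (ε / 2) ^ 2 ≤ (∑ j, W j v) ^ 2} := by
    refine measureReal_mono fun v hv => ?_
    simp only [Set.mem_ofPred_eq] at hv ⊢
    refine pow_le_pow_left₀ (by positivity) ?_ 2
    have h1 : lowerRow v i ⬝ᵥ lowerRow v i ≤ ∑ j, (W j v + centeredSqVar d) := by
      refine Finset.sum_le_sum fun j _ => ?_
      simp only [lowerRow, hW]
      split_ifs
      · linarith
      · simpa using hvar
    rw [Finset.sum_add_distrib] at h1
    simp only [Finset.sum_const, Finset.card_univ, Fintype.card_fin, nsmul_eq_mul] at h1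
    linarith
  rw [mul_div_assoc', le_div_iff₀ (by positivity)]
  nlinarith

theorem sum_pow_mul_centeredSq_le {d m : ℕ} {v : Fin m → 𝔼 d} (hd : 1 ≤ d)
    (hv : ∀ i, ‖v i‖ = 1) (i : Fin m) {N : ℕ} (hN : Even N)
    (htr : (partialGram v i ^ N).trace < 1) :
    ∑ j, ∑ k, (partialGram v i ^ N) j k *
      (if j < i ∧ k < i then centeredSq (v j) (v k) else 0) ≤
        2 * (partialGram v i ^ N).trace := by
  have hd' : (1 : ℝ) ≤ d := by exact_mod_cast hd
  set T := partialGram v i with hT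
  have hTh : T.IsHermitian := isHermitian_partialGram v i
  have hQ : ∀ j, 0 ≤ (T ^ N) j j := by
    intro j
    have := hTh.dotProduct_pow_mulVec (Pi.single j 1) N
    rw [single_one_dotProduct, mulVec_single_one, col_apply] at this
    rw [this]
    exact Finset.sum_nonneg fun _ _ => mul_nonneg (sq_nonneg _) (hN.pow_nonneg _)
  have hent : ∀ j k, (if j < i ∧ k < i then centeredSq (v j) (v k) else 0) =
      T k j + if j = k ∧ j < i then (1 - 1 / d : ℝ) else 0 := by
    intro j k
    simp only [hT, partialGram, of_apply, centeredSq_comm (v k), Fin.val_fin_lt]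
    by_cases hjk : j = k
    · subst hjk
      simp [centeredSq_self (hv j)]
    · simp [hjk, ne_comm (a := k), and_comm]
  have h1 : ∀ j, ∑ k, (T ^ N) j k * (if j < i ∧ k < i then centeredSq (v j) (v k) else 0) ≤
      (T ^ (N + 1)) j j + (T ^ N) j j := by
    intro j
    simp only [hent, mul_add, Finset.sum_add_distrib]
    rw [pow_succ T N, mul_apply]
    gcongr
    rw [Finset.sum_eq_single j (fun k _ hk => by simp [hk.symm]) (by simp)]
    refine mul_le_of_le_one_right (hQ j) ?_
    split_ifs
    · have : 0 ≤ 1 / (d : ℝ) := by positivity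
      linarith
    · exact zero_le_one
  calc _ ≤ ∑ j, ((T ^ (N + 1)) j j + (T ^ N) j j) := Finset.sum_le_sum fun j _ => h1 j
    _ = (T ^ (N + 1)).trace + (T ^ N).trace := by
        rw [Finset.sum_add_distrib]; rfl
    _ ≤ _ := by linarith [hTh.trace_pow_succ_le hN htr]

end PartialGram

section Growth

open Matrix

/-- The event that, before step `n`, all traces of powers and all row norms are small. -/
def goodEvent (d m N : ℕ) (ε : ℝ) (n : ℕ) : Set (Fin m → EuclideanSpace ℝ (Fin d)) :=
  {v | ∀ i : Fin m, i.val < n →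
    (partialGram v i ^ N).trace < 2⁻¹ ^ N ∧ lowerRow v i ⬝ᵥ lowerRow v i ≤ ε}

@[fun_prop]
theorem continuous_trace_partialGram_pow {d m : ℕ} (n N : ℕ) :
    Continuous fun v : Fin m → EuclideanSpace ℝ (Fin d) => (partialGram v n ^ N).trace := by
  fun_prop

@[fun_prop]
theorem continuous_lowerRow_sq {d m : ℕ} (i : Fin m) :
    Continuous fun v : Fin m → EuclideanSpace ℝ (Fin d) => lowerRow v i ⬝ᵥ lowerRow v i := by
  fun_prop

theorem measurableSet_goodEvent (d m N : ℕ) (ε : ℝ) (n : ℕ) :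
    MeasurableSet (goodEvent d m N ε n) := by
  simp only [goodEvent, Set.ofPred_forall]
  refine MeasurableSet.iInter fun i => MeasurableSet.iInter fun _ => ?_
  exact (measurableSet_lt (continuous_trace_partialGram_pow i N).measurable measurable_const).inter
    (measurableSet_le (continuous_lowerRow_sq i).measurable measurable_const)

theorem Matrix.IsHermitian.dotProduct_pow_mulVec_nonneg {ι : Type*} [Fintype ι] [DecidableEq ι]
    {A : Matrix ι ι ℝ} (hA : A.IsHermitian) {N : ℕ} (hN : Even N) (a : ι → ℝ) :
    0 ≤ a ⬝ᵥ (A ^ N *ᵥ a) := by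
  rw [hA.dotProduct_pow_mulVec]
  exact Finset.sum_nonneg fun _ _ => mul_nonneg (sq_nonneg _) (hN.pow_nonneg _)

theorem integral_lowerRow_update_pow {d m : ℕ} (hd : 1 ≤ d)
    {v : Fin m → EuclideanSpace ℝ (Fin d)} (hv : ∀ i, ‖v i‖ = 1) (i : Fin m) (N : ℕ) :
    ∫ x, lowerRow (Function.update v i x) i ⬝ᵥ
        (partialGram v i ^ N *ᵥ lowerRow (Function.update v i x) i) ∂uniformSphere d =
      2 / (d * (d + 2)) * ∑ j, ∑ k, (partialGram v i ^ N) j k *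
        (if j < i ∧ k < i then centeredSq (v j) (v k) else 0) := by
  have h1 : ∀ x, lowerRow (Function.update v i x) i ⬝ᵥ
        (partialGram v i ^ N *ᵥ lowerRow (Function.update v i x) i) =
      ∑ j, ∑ k, (partialGram v i ^ N) j k *
        (if j < i ∧ k < i then centeredSq (v j) x * centeredSq (v k) x else 0) := by
    intro x
    simp only [dotProduct, mulVec, Finset.mul_sum, lowerRow_update_self]
    refine Finset.sum_congr rfl fun j _ => Finset.sum_congr rfl fun k _ => ?_
    by_cases hj : j < i <;> by_cases hk : k < i <;> simp [hj, hk]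
    ring
  have hc : ∀ j k, Continuous fun x => (partialGram v i ^ N) j k *
        (if j < i ∧ k < i then centeredSq (v j) x * centeredSq (v k) x else 0) := by
    intro j k
    split_ifs <;> fun_prop
  simp only [h1]
  rw [integral_finsetSum _ fun j _ => integrable_finsetSum _ fun k _ =>
    integrable_uniformSphere hd (hc j k), Finset.mul_sum]
  refine Finset.sum_congr rfl fun j _ => ?_
  rw [integral_finsetSum _ fun k _ => integrable_uniformSphere hd (hc j k), Finset.mul_sum]
  refine Finset.sum_congr rfl fun k _ => ?_
  rw [integral_const_mul]
  split_ifs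
  · rw [integral_centeredSq_mul hd (hv j) (hv k)]
    ring
  · simp

theorem setIntegral_goodEvent_succ_le {d m N : ℕ} (hd : 1 ≤ d) (i : Fin m) {ε : ℝ} (hε : 0 ≤ ε)
    (hN2 : 2 ≤ N) (hN : Even N) (hNε : 16 * N * ε ≤ 1) :
    ∫ v in goodEvent d m N ε (i + 1), (partialGram v (i + 1) ^ N).trace
        ∂(Measure.pi fun _ : Fin m => uniformSphere d) ≤
      (1 + 64 * N ^ 2 / d ^ 2) * ∫ v in goodEvent d m N ε i, (partialGram v i ^ N).trace
        ∂(Measure.pi fun _ : Fin m => uniformSphere d) + 16 * N ^ 2 * (4⁻¹ ^ N * ε) := by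
  have := isProbabilityMeasure_uniformSphere hd
  have hd' : (1 : ℝ) ≤ d := by exact_mod_cast hd
  set μ := Measure.pi fun _ : Fin m => uniformSphere d with hμ
  set H : Set (Fin m → EuclideanSpace ℝ (Fin d)) :=
    goodEvent d m N ε i ∩ {v | (partialGram v i ^ N).trace < 2⁻¹ ^ N} with hH
  have hHm : MeasurableSet H := (measurableSet_goodEvent d m N ε i).inter
    (measurableSet_lt (continuous_trace_partialGram_pow i N).measurable measurable_const)
  have htr : ∀ (v : Fin m → EuclideanSpace ℝ (Fin d)) n, 0 ≤ (partialGram v n ^ N).trace :=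
    fun v n => (isHermitian_partialGram v n).trace_pow_nonneg hN
  set q : (Fin m → EuclideanSpace ℝ (Fin d)) → ℝ := fun v =>
    lowerRow v i ⬝ᵥ (partialGram v i ^ N *ᵥ lowerRow v i) with hq
  have hq0 : ∀ v, 0 ≤ q v := fun v =>
    (isHermitian_partialGram v i).dotProduct_pow_mulVec_nonneg hN _
  have hqc : Continuous q := by fun_prop
  have hTi : Integrable (fun v => (partialGram v i ^ N).trace) μ :=
    integrable_pi_uniformSphere hd (by fun_prop)
  have hqi : Integrable q μ := integrable_pi_uniformSphere hd hqc
  have hHF : ∫ v in H, (partialGram v i ^ N).trace ∂μ ≤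
      ∫ v in goodEvent d m N ε i, (partialGram v i ^ N).trace ∂μ :=
    setIntegral_mono_set hTi.integrableOn (Filter.Eventually.of_forall fun v => htr v i)
      Set.inter_subset_left.eventuallyLE
  have hHu : ∀ v x, Function.update v i x ∈ H ↔ v ∈ H := by
    intro v x
    simp only [hH, goodEvent, Set.mem_inter_iff, Set.mem_ofPred_eq,
      partialGram_update v i x le_rfl]
    refine and_congr_left' (forall_congr' fun j => forall_congr' fun hj => ?_)
    rw [partialGram_update v i x hj.le, lowerRow_update v i x hj]
  have hqH : ∫ v in H, q v ∂μ ≤ 4 / d ^ 2 * ∫ v in H, (partialGram v i ^ N).trace ∂μ := by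
    rw [← integral_indicator hHm, ← integral_indicator hHm, hμ,
      integral_pi_eq_integral_update _ i (hqi.indicator hHm), ← integral_const_mul]
    refine integral_mono_of_nonneg (Filter.Eventually.of_forall fun v => integral_nonneg fun x =>
      Set.indicator_nonneg (fun v _ => hq0 v) _) ((hTi.indicator hHm).const_mul _) ?_
    filter_upwards [ae_norm_pi_uniformSphere hd m] with v hv
    by_cases hvH : v ∈ H
    · simp only [Set.indicator, hHu, hvH, if_true, hq, partialGram_update v i _ le_rfl]
      rw [integral_lowerRow_update_pow hd hv]
      have h1 : (partialGram v i ^ N).trace < 1 :=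
        hvH.2.trans_le (pow_le_one₀ (by norm_num) (by norm_num))
      calc _ ≤ 2 / (d * (d + 2) : ℝ) * (2 * (partialGram v i ^ N).trace) := by
            gcongr
            exact sum_pow_mul_centeredSq_le hd hv i hN h1
        _ = 4 / (d * (d + 2) : ℝ) * (partialGram v i ^ N).trace := by ring
        _ ≤ _ := by
            refine mul_le_mul_of_nonneg_right ?_ (htr v i)
            gcongr
            nlinarith
    · simp [Set.indicator, hHu, hvH]
  have hpt : ∀ v, (goodEvent d m N ε (i + 1)).indicator
      (fun v => (partialGram v (i + 1) ^ N).trace) v ≤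
      H.indicator (fun v => (partialGram v i ^ N).trace) v + 16 * N ^ 2 * H.indicator q v +
        16 * N ^ 2 * (4⁻¹ ^ N * ε) := by
    intro v
    by_cases hv : v ∈ goodEvent d m N ε (i + 1)
    · have hrow := (hv i (Nat.lt_succ_self _)).2
      have hvH : v ∈ H :=
        ⟨fun j hj => hv j (Nat.lt_succ_of_lt hj), (hv i (Nat.lt_succ_self _)).1⟩
      simp only [Set.indicator_of_mem hv, Set.indicator_of_mem hvH]
      have hNa : 16 * N * (lowerRow v i ⬝ᵥ lowerRow v i) ≤ 1 :=
        (mul_le_mul_of_nonneg_left hrow (by positivity)).trans hNε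
      have h := trace_pow_rank_two_update_le (isHermitian_partialGram v i)
        (a := lowerRow v i) (e := Pi.single i 1) (by simp) (partialGram_mulVec_single v i)
        (lowerRow_dotProduct_single v i) hN2 hN hNa
      rw [← partialGram_succ] at h
      have h4 : (4⁻¹ : ℝ) ^ N * (lowerRow v i ⬝ᵥ lowerRow v i) ≤ 4⁻¹ ^ N * ε := by gcongr
      have h5 := mul_le_mul_of_nonneg_left h4 (by positivity : (0 : ℝ) ≤ 16 * N ^ 2)
      simp only [hq]
      linarith
    · rw [Set.indicator_of_notMem hv]
      have := Set.indicator_nonneg (s := H) (fun v _ => hq0 v) v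
      have := Set.indicator_nonneg (s := H) (fun v _ => htr v i) v
      positivity
  have hi1 := (hTi.indicator hHm).add ((hqi.indicator hHm).const_mul (16 * (N : ℝ) ^ 2))
  have hi2 : Integrable (fun v => (partialGram v (i + 1) ^ N).trace) μ :=
    integrable_pi_uniformSphere hd (by fun_prop)
  have hmono := integral_mono (hi2.indicator (measurableSet_goodEvent d m N ε (i + 1)))
    (hi1.add (integrable_const (16 * (N : ℝ) ^ 2 * (4⁻¹ ^ N * ε)))) hpt
  simp only [Pi.add_apply] at hmono
  rw [integral_indicator (measurableSet_goodEvent d m N ε (i + 1)),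
    integral_add (by exact hi1) (integrable_const _),
    integral_add (hTi.indicator hHm) ((hqi.indicator hHm).const_mul _), integral_const_mul,
    integral_indicator hHm, integral_indicator hHm] at hmono
  simp only [integral_const, probReal_univ, one_smul] at hmono
  have h6 := mul_le_mul_of_nonneg_left hqH (by positivity : (0 : ℝ) ≤ 16 * N ^ 2)
  have h7 := mul_le_mul_of_nonneg_left hHF
    (by positivity : (0 : ℝ) ≤ 1 + 16 * N ^ 2 * (4 / d ^ 2))
  calc _ ≤ _ := hmono
    _ ≤ (1 + 16 * N ^ 2 * (4 / d ^ 2)) * ∫ v in H, (partialGram v i ^ N).trace ∂μ +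
        16 * N ^ 2 * (4⁻¹ ^ N * ε) := by linarith
    _ ≤ _ := by
        refine (add_le_add_left h7 _).trans (le_of_eq ?_)
        ring

theorem setIntegral_goodEvent_le {d m N : ℕ} (hd : 1 ≤ d) {ε : ℝ} (hε : 0 ≤ ε)
    (hN2 : 2 ≤ N) (hN : Even N) (hNε : 16 * N * ε ≤ 1) {n : ℕ} (hn : n ≤ m) :
    ∫ v in goodEvent d m N ε n, (partialGram v n ^ N).trace
        ∂(Measure.pi fun _ : Fin m => uniformSphere d) ≤
      n * (16 * N ^ 2 * (4⁻¹ ^ N * ε)) * (1 + 64 * N ^ 2 / d ^ 2) ^ n := by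
  induction n with
  | zero =>
    have : N ≠ 0 := by omega
    simp [partialGram_zero, this]
  | succ n ih =>
    refine (setIntegral_goodEvent_succ_le hd ⟨n, hn⟩ hε hN2 hN hNε).trans ?_
    have hα : (0 : ℝ) ≤ 64 * N ^ 2 / d ^ 2 := by positivity
    have h1 := mul_le_mul_of_nonneg_left (ih (by omega)) (by positivity :
      (0 : ℝ) ≤ 1 + 64 * N ^ 2 / d ^ 2)
    have h2 : (1 : ℝ) ≤ (1 + 64 * N ^ 2 / d ^ 2) ^ (n + 1) := one_le_pow₀ (by linarith)
    have h3 := mul_le_mul_of_nonneg_left h2 (by positivity :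
      (0 : ℝ) ≤ 16 * N ^ 2 * (4⁻¹ ^ N * ε))
    rw [mul_one] at h3
    refine (add_le_add h1 h3).trans (le_of_eq ?_)
    push_cast
    ring

end Growth

section TailBound

open Matrix

theorem measureReal_trace_partialGram_ge_le {d m N : ℕ} (hd : 1 ≤ d) {ε : ℝ} (hε : 0 < ε)
    (hN2 : 2 ≤ N) (hN : Even N) (hNε : 16 * N * ε ≤ 1) (hm : m * centeredSqVar d ≤ ε / 2) :
    (Measure.pi fun _ : Fin m => uniformSphere d).real
        {v | 2⁻¹ ^ N ≤ (partialGram v m ^ N).trace} ≤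
      m * (m * (2000000 / d ^ 4) * (4 / ε ^ 2)) + (m + 1) *
        (2 ^ N * (m * (16 * N ^ 2 * (4⁻¹ ^ N * ε)) * (1 + 64 * N ^ 2 / d ^ 2) ^ m)) := by
  have := isProbabilityMeasure_uniformSphere hd
  set μ := Measure.pi fun _ : Fin m => uniformSphere d with hμ
  set R : Set (Fin m → EuclideanSpace ℝ (Fin d)) :=
    ⋃ i : Fin m, {v | ε < lowerRow v i ⬝ᵥ lowerRow v i} with hR
  set E : ℕ → Set (Fin m → EuclideanSpace ℝ (Fin d)) := fun n =>
    goodEvent d m N ε n ∩ {v | 2⁻¹ ^ N ≤ (partialGram v n ^ N).trace} with hE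
  have hsub : {v : Fin m → EuclideanSpace ℝ (Fin d) | 2⁻¹ ^ N ≤ (partialGram v m ^ N).trace} ⊆
      R ∪ ⋃ n ∈ Finset.range (m + 1), E n := by
    intro v hv
    by_contra hcon
    simp only [hR, hE, Set.mem_union, Set.mem_iUnion, Set.mem_inter_iff, Set.mem_ofPred_eq,
      Finset.mem_range, exists_prop, not_or, not_exists, not_and, not_lt, not_le] at hcon
    obtain ⟨hrow, hstep⟩ := hcon
    have hgood : ∀ n ≤ m, v ∈ goodEvent d m N ε n := by
      intro n
      induction n with
      | zero => exact fun _ i hi => absurd hi (Nat.not_lt_zero _)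
      | succ n ih =>
        intro hn i hi
        rcases Nat.lt_succ_iff_lt_or_eq.1 hi with h | h
        · exact ih (by omega) i h
        · refine ⟨?_, hrow i⟩
          rw [h]
          exact hstep n (by omega) (ih (by omega))
    exact absurd (hstep m (by omega) (hgood m le_rfl)) (not_lt.2 hv)
  have hRle : μ.real R ≤ m * (m * (2000000 / d ^ 4) * (4 / ε ^ 2)) :=
    calc μ.real R ≤ ∑ i : Fin m, μ.real {v | ε < lowerRow v i ⬝ᵥ lowerRow v i} :=
          measureReal_iUnion_fintype_le _
      _ ≤ ∑ i : Fin m, (m * (2000000 / d ^ 4) * (4 / ε ^ 2) : ℝ) :=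
          Finset.sum_le_sum fun i _ => measureReal_lt_lowerRow_sq_le hd i hε hm
      _ = _ := by simp
  have hEn : ∀ n ∈ Finset.range (m + 1), μ.real (E n) ≤
      2 ^ N * (m * (16 * N ^ 2 * (4⁻¹ ^ N * ε)) * (1 + 64 * N ^ 2 / d ^ 2) ^ m) := by
    intro n hn
    have hnm : n ≤ m := Nat.lt_succ_iff.1 (Finset.mem_range.1 hn)
    have hgm := measurableSet_goodEvent d m N ε n
    have hti : Integrable (fun v => (partialGram v n ^ N).trace) μ :=
      integrable_pi_uniformSphere hd (by fun_prop)
    have h1 := mul_meas_ge_le_integral_of_nonneg (μ := μ)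
      (f := (goodEvent d m N ε n).indicator fun v => (partialGram v n ^ N).trace)
      (Filter.Eventually.of_forall fun v => Set.indicator_nonneg
        (fun v _ => (isHermitian_partialGram v n).trace_pow_nonneg hN) v)
      (hti.indicator hgm) (2⁻¹ ^ N)
    rw [integral_indicator hgm] at h1
    have h2 := h1.trans (setIntegral_goodEvent_le hd hε.le hN2 hN hNε hnm)
    have h3 : μ.real (E n) ≤ μ.real {v | 2⁻¹ ^ N ≤ (goodEvent d m N ε n).indicator
        (fun v => (partialGram v n ^ N).trace) v} := by
      refine measureReal_mono fun v hv => ?_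
      simp only [Set.mem_ofPred_eq, Set.indicator_of_mem hv.1]
      exact hv.2
    have hα : (1 : ℝ) ≤ 1 + 64 * N ^ 2 / d ^ 2 := le_add_of_nonneg_right (by positivity)
    calc μ.real (E n) ≤ _ := h3
      _ = 2 ^ N * (2⁻¹ ^ N * _) := by
          rw [← mul_assoc, ← mul_pow, mul_inv_cancel₀ two_ne_zero, one_pow, one_mul]
      _ ≤ 2 ^ N * (n * (16 * N ^ 2 * (4⁻¹ ^ N * ε)) * (1 + 64 * N ^ 2 / d ^ 2) ^ n) := by
          gcongr
      _ ≤ _ := by gcongr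
  calc _ ≤ μ.real (R ∪ ⋃ n ∈ Finset.range (m + 1), E n) := measureReal_mono hsub
    _ ≤ μ.real R + μ.real (⋃ n ∈ Finset.range (m + 1), E n) := measureReal_union_le _ _
    _ ≤ _ := by
        refine add_le_add hRle ((measureReal_biUnion_finset_le _ _).trans ?_)
        refine (Finset.sum_le_sum hEn).trans (le_of_eq ?_)
        simp

theorem centeredSqVar_le {d : ℕ} (hd : 1 ≤ d) : centeredSqVar d ≤ 2 / d ^ 2 := by
  have hd' : (1 : ℝ) ≤ d := by exact_mod_cast hd
  calc centeredSqVar d ≤ 2 / (d * (d + 2)) * 1 := by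
        unfold centeredSqVar
        gcongr
        exact sub_le_self _ (by positivity)
    _ ≤ _ := by
        rw [mul_one]
        gcongr
        nlinarith

theorem exists_even_measureReal_trace_le {d m : ℕ} (hm : 1 ≤ m) (hL : 100 ≤ Real.log d)
    (hmd : (m : ℝ) ≤ d ^ 2 / Real.log d ^ 4) :
    ∃ N : ℕ, Even N ∧ (Measure.pi fun _ : Fin m => uniformSphere d).real
        {v | 2⁻¹ ^ N ≤ (partialGram v m ^ N).trace} ≤ 400000000000 / Real.log d := by
  have hd : 1 ≤ d := by
    rcases Nat.eq_zero_or_pos d with rfl | h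
    · norm_num at hL
    · exact h
  have hd' : (1 : ℝ) ≤ d := by exact_mod_cast hd
  have hm' : (1 : ℝ) ≤ m := by exact_mod_cast hm
  set L := Real.log d with hLdef
  have hL0 : 0 < L := by linarith
  set N := 2 * ⌈5 * L⌉₊ with hNdef
  have hNlow : 10 * L ≤ N := by
    have := Nat.le_ceil (5 * L)
    simp only [hNdef]
    push_cast
    linarith
  have hNup : (N : ℝ) ≤ 12 * L := by
    have := Nat.ceil_lt_add_one (by positivity : 0 ≤ 5 * L)
    simp only [hNdef]
    push_cast
    linarith
  have hN0 : (0 : ℝ) < N := by linarith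
  have hN2 : 2 ≤ N := by
    have : (2 : ℝ) ≤ N := by linarith
    exact_mod_cast this
  have hNe : Even N := even_two_mul _
  have hpow : (d : ℝ) ^ 4 ≤ 2 ^ N := by
    rw [← Real.log_le_log_iff (by positivity) (by positivity), Real.log_pow, Real.log_pow,
      ← hLdef]
    have := Real.log_two_gt_d9
    push_cast
    nlinarith
  have hx : (m : ℝ) / d ^ 2 ≤ 1 / L ^ 4 := by
    rw [le_div_iff₀ (by positivity)] at hmd
    rw [div_le_div_iff₀ (by positivity) (by positivity)]
    linarith
  have hx0 : (0 : ℝ) ≤ m / d ^ 2 := by positivity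
  have hx2 : ((m : ℝ) / d ^ 2) ^ 2 ≤ 1 / L ^ 8 := by
    calc _ ≤ (1 / L ^ 4) ^ 2 := pow_le_pow_left₀ hx0 hx 2
      _ = _ := by ring
  have hvar : m * centeredSqVar d ≤ 1 / (16 * (N : ℝ)) / 2 := by
    calc _ ≤ m * (2 / d ^ 2 : ℝ) := by gcongr; exact centeredSqVar_le hd
      _ = 2 * (m / d ^ 2) := by ring
      _ ≤ 2 * (1 / L ^ 4) := by gcongr
      _ ≤ 1 / (16 * (12 * L)) / 2 := by
          rw [mul_one_div, div_div, div_le_div_iff₀ (by positivity) (by positivity)]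
          have : (100 : ℝ) ^ 3 ≤ L ^ 3 := by gcongr
          nlinarith
      _ ≤ _ := by gcongr
  have hbound := measureReal_trace_partialGram_ge_le hd (ε := 1 / (16 * (N : ℝ)))
    (by positivity) hN2 hNe (by rw [mul_one_div_cancel (by positivity)]) hvar
  refine ⟨N, hNe, hbound.trans ?_⟩
  have hL1 : ∀ k : ℕ, 1 / L ^ (k + 1) ≤ 1 / L := fun k => by
    rw [pow_succ]
    gcongr
    exact le_mul_of_one_le_left hL0.le (one_le_pow₀ (by linarith))
  have hgrow : (1 + 64 * (N : ℝ) ^ 2 / d ^ 2) ^ m ≤ 3 := by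
    have h1 : m * (64 * (N : ℝ) ^ 2 / d ^ 2) ≤ 1 := by
      calc _ = 64 * (N : ℝ) ^ 2 * (m / d ^ 2) := by ring
        _ ≤ 64 * (12 * L) ^ 2 * (1 / L ^ 4) := by gcongr
        _ = 9216 / L ^ 2 := by field_simp; norm_num
        _ ≤ 1 := by
            rw [div_le_one (by positivity)]
            nlinarith
    calc _ ≤ Real.exp (64 * (N : ℝ) ^ 2 / d ^ 2) ^ m := by
          gcongr
          rw [add_comm]
          exact Real.add_one_le_exp _
      _ = Real.exp (m * (64 * (N : ℝ) ^ 2 / d ^ 2)) := (Real.exp_nat_mul _ _).symm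
      _ ≤ Real.exp 1 := Real.exp_le_exp.2 h1
      _ ≤ 3 := Real.exp_one_lt_three.le
  have hfirst : (m : ℝ) * (m * (2000000 / d ^ 4) * (4 / (1 / (16 * (N : ℝ))) ^ 2)) ≤
      294912000000 * (1 / L) := by
    calc _ = 2048000000 * (N : ℝ) ^ 2 * (m / d ^ 2 : ℝ) ^ 2 := by field_simp; norm_num
      _ ≤ 2048000000 * (12 * L) ^ 2 * (1 / L ^ 8) := by gcongr
      _ = 294912000000 * (1 / L ^ (5 + 1)) := by field_simp; ring
      _ ≤ _ := mul_le_mul_of_nonneg_left (hL1 5) (by norm_num)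
  have hsecond : ((m : ℝ) + 1) * (2 ^ N * (m * (16 * N ^ 2 * (4⁻¹ ^ N * (1 / (16 * (N : ℝ))))) *
      (1 + 64 * N ^ 2 / d ^ 2) ^ m)) ≤ 72 * (1 / L) := by
    have h24 : (2 : ℝ) ^ N * 4⁻¹ ^ N = (2 ^ N)⁻¹ := by
      rw [← mul_pow, ← inv_pow]
      norm_num
    calc _ ≤ ((m : ℝ) + m) *
          (2 ^ N * (m * (16 * N ^ 2 * (4⁻¹ ^ N * (1 / (16 * (N : ℝ))))) * 3)) := by
          gcongr
      _ = 6 * m ^ 2 * (16 * N ^ 2 * (1 / (16 * (N : ℝ)))) * (2 ^ N * 4⁻¹ ^ N) := by ring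
      _ = 6 * m ^ 2 * N * (2 ^ N)⁻¹ := by
          rw [h24]
          congr 2
          field_simp
      _ ≤ 6 * m ^ 2 * N * ((d : ℝ) ^ 4)⁻¹ := by gcongr
      _ = 6 * N * (m / d ^ 2 : ℝ) ^ 2 := by field_simp
      _ ≤ 6 * (12 * L) * (1 / L ^ 8) := by gcongr
      _ = 72 * (1 / L ^ (6 + 1)) := by field_simp; ring
      _ ≤ _ := mul_le_mul_of_nonneg_left (hL1 6) (by norm_num)
  have hLi : 0 ≤ 1 / L := by positivity
  calc _ ≤ 294912000000 * (1 / L) + 72 * (1 / L) := add_le_add hfirst hsecond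
    _ ≤ 400000000000 * (1 / L) := by linarith
    _ = _ := mul_one_div _ _

theorem gram_sub_eq_partialGram {d m : ℕ} {v : Fin m → EuclideanSpace ℝ (Fin d)}
    (hv : ∀ i, ‖v i‖ = 1) :
    (Matrix.of fun i j : Fin m => (∑ k, v i k * v j k) ^ 2)
      - (1 - 1 / (d : ℝ)) • (1 : Matrix (Fin m) (Fin m) ℝ)
      - (1 / (d : ℝ)) • Matrix.of (fun _ _ : Fin m => (1 : ℝ)) = partialGram v m := by
  ext i j
  have h1 : ∑ k, v i k * v j k = inner ℝ (v i) (v j) := by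
    rw [PiLp.inner_apply]
    exact Finset.sum_congr rfl fun k _ => by simp [mul_comm]
  simp only [Matrix.sub_apply, Matrix.smul_apply, of_apply, h1, partialGram, i.isLt, j.isLt,
    and_true, smul_eq_mul, mul_one]
  by_cases hij : i = j
  · subst hij
    simp [hv i]
  · simp [hij, centeredSq]

end TailBound

/-- There is a universal `c > 0` such that for every `η > 0` there is `d₀` such that for all
`d ≥ d₀` and positive `m ≤ c·d²/log⁴(d)`: if `v⁽¹⁾,…,v⁽ᵐ⁾` are i.i.d. uniform on the sphere,
`M_{ij} = (v⁽ⁱ⁾·v⁽ʲ⁾)²` and `A = M − (1 − 1/d)·I − (1/d)·𝟙𝟙ᵀ`, then `Pr(‖A‖₂ < 1/2) ≥ 1 − η`. -/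
theorem A_norm_bound :
    ∃ c : ℝ, 0 < c ∧ ∀ η : ℝ, 0 < η → ∃ d₀ : ℕ, ∀ d : ℕ, d₀ ≤ d → ∀ m : ℕ,
      1 ≤ m → (m : ℝ) ≤ c * d ^ 2 / (Real.log d) ^ 4 →
      ENNReal.ofReal (1 - η) ≤
        (Measure.pi fun _ : Fin m => uniformSphere d)
          {v : Fin m → EuclideanSpace ℝ (Fin d) |
            opNorm
              ((Matrix.of fun i j : Fin m => (∑ k, v i k * v j k) ^ 2)
                - (1 - 1 / (d : ℝ)) • (1 : Matrix (Fin m) (Fin m) ℝ)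
                - (1 / (d : ℝ)) • Matrix.of (fun _ _ : Fin m => (1 : ℝ))) < 1 / 2} := by
  refine ⟨1, one_pos, fun η hη => ?_⟩
  have hlim : Filter.Tendsto (fun d : ℕ => Real.log d) Filter.atTop Filter.atTop :=
    Real.tendsto_log_atTop.comp tendsto_natCast_atTop_atTop
  obtain ⟨d₀, hd₀⟩ := Filter.eventually_atTop.1
    ((hlim.eventually_ge_atTop 100).and (hlim.eventually_ge_atTop (400000000000 / η)))
  refine ⟨d₀, fun d hdd m hm hmd => ?_⟩
  obtain ⟨hL, hLη⟩ := hd₀ d hdd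
  rw [one_mul] at hmd
  have hd : 1 ≤ d := by
    rcases Nat.eq_zero_or_pos d with rfl | h
    · norm_num at hL
    · exact h
  have := isProbabilityMeasure_uniformSphere hd
  obtain ⟨N, hN, hbad⟩ := exists_even_measureReal_trace_le hm hL hmd
  set μ := Measure.pi fun _ : Fin m => uniformSphere d with hμ
  set B : Set (Fin m → EuclideanSpace ℝ (Fin d)) :=
    {v | 2⁻¹ ^ N ≤ (partialGram v m ^ N).trace} with hB
  have hBm : MeasurableSet B :=
    measurableSet_le measurable_const (continuous_trace_partialGram_pow m N).measurable
  have hBη : μ.real B ≤ η := by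
    refine hbad.trans ?_
    rw [div_le_iff₀ hη] at hLη
    rw [div_le_iff₀ (by linarith)]
    linarith
  calc ENNReal.ofReal (1 - η) ≤ ENNReal.ofReal (μ.real Bᶜ) := by
        refine ENNReal.ofReal_le_ofReal ?_
        rw [probReal_compl_eq_one_sub hBm]
        linarith
    _ = μ Bᶜ := ofReal_measureReal
    _ ≤ _ := by
        refine measure_mono_ae ?_
        filter_upwards [ae_norm_pi_uniformSphere hd m] with v hv hvB
        have h1 : (partialGram v m ^ N).trace < (1 / 2) ^ N := by
          rw [one_div]
          exact not_le.1 hvB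
        change opNorm _ < 1 / 2
        rw [gram_sub_eq_partialGram hv]
        exact opNorm_lt_of_trace_pow_lt (isHermitian_partialGram v m) hN (by norm_num) h1
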